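/- arXiv:quant-ph/0608072 — 3 statements merged into one kernel-verified Lean document; each statement's English description precedes it below -/
import Mathlib

section
/- Finite-dimensional Naimark theorem: for every POVM F : ι → Matrix (Fin d) (Fin d) ℂ (with ι a finite type, each F i positive semidefinite, and ∑ i, F i = 1), there exist an isometry V : Matrix (ι × Fin d) (Fin d) ℂ (i.e. Vᴴ * V = 1) and a projective measurement P : ι → Matrix (ι × Fin d) (ι × Fin d) ℂ (each P i self-adjoint and idempotent, P i * P j = 0 for i ≠ j, and ∑ i, P i = 1) such that F i = Vᴴ * P i * V for every i. -/
open Matrix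
open scoped ComplexOrder

/-- Every positive semidefinite complex matrix is a Gram matrix. -/
theorem Matrix.PosSemidef.exists_eq_conjTranspose_mul_self {n : Type*} [Fintype n] [DecidableEq n]
    {A : Matrix n n ℂ} (hA : A.PosSemidef) : ∃ B : Matrix n n ℂ, A = Bᴴ * B := by
  open scoped MatrixOrder Matrix.Norms.L2Operator in
  exact CStarAlgebra.nonneg_iff_eq_star_mul_self.mp hA.nonneg

/-- Finite-dimensional Naimark theorem: every POVM is the compression of a
projective measurement on an extended system by an isometry. -/
theorem naimark_dilation {ι : Type*} [Fintype ι] [DecidableEq ι] {d : ℕ}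
    (F : ι → Matrix (Fin d) (Fin d) ℂ)
    (hF : ∀ i, (F i).PosSemidef) (hFsum : ∑ i, F i = 1) :
    ∃ (V : Matrix (ι × Fin d) (Fin d) ℂ)
      (P : ι → Matrix (ι × Fin d) (ι × Fin d) ℂ),
      Vᴴ * V = 1 ∧
      (∀ i, (P i)ᴴ = P i) ∧
      (∀ i, P i * P i = P i) ∧
      (∀ i j, i ≠ j → P i * P j = 0) ∧
      (∑ i, P i = 1) ∧
      (∀ i, F i = Vᴴ * P i * V) := by
  choose B hB using fun i => (hF i).exists_eq_conjTranspose_mul_self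
  let V : Matrix (ι × Fin d) (Fin d) ℂ := Matrix.of fun p b => B p.1 p.2 b
  let P : ι → Matrix (ι × Fin d) (ι × Fin d) ℂ :=
    fun i => diagonal fun p => if p.1 = i then 1 else 0
  have hP : ∑ i, P i = 1 := by
    ext p q
    by_cases h : p = q <;> simp [P, Matrix.sum_apply, one_apply, h]
  have hV : ∀ i, F i = Vᴴ * P i * V := by
    intro i
    rw [hB i]
    ext a b
    rw [mul_apply, mul_apply, Fintype.sum_prod_type]
    simp only [P, V, mul_diagonal, conjTranspose_apply, of_apply]
    rw [Finset.sum_eq_single i]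
    · simp
    · intro j _ hj
      simp [hj]
    · simp
  refine ⟨V, P, ?_, ?_, ?_, ?_, hP, hV⟩
  · rw [← hFsum, Finset.sum_congr rfl fun i _ => hV i, ← Matrix.sum_mul, ← Matrix.mul_sum,
      hP, Matrix.mul_one]
  · intro i
    ext p q
    by_cases h : p = q
    · subst h
      simp [P, apply_ite]
    · simp [P, h, Ne.symm h]
  · intro i
    simp [P, diagonal_mul_diagonal]
  · intro i j hij
    rw [diagonal_mul_diagonal, ← diagonal_zero]
    congr 1
    funext p
    by_cases h : p.1 = i <;> simp [h, hij]
end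

section
/- Spider fusion (normal form for classical networks): for d, m, n, k : ℕ define the spider matrix S d m n : Matrix (Fin m → Fin d) (Fin n → Fin d) ℂ by (S d m n) j k = 1 if there exists c : Fin d with j a = c for all a and k b = c for all b, and (S d m n) j k = 0 otherwise. Then for all m, n, k with 1 ≤ m and 1 ≤ n, one has S d n m * S d m k = S d n k. -/
open Matrix

/-- The spider matrix `S d m n`: the normal form `δ_m ∘ δ_n†` of a connected
classical network with `m` inputs and `n` outputs on the classical object
`ℂ^d`.  Its `(j, k)` entry is `1` exactly when `j` and `k` are both constant
with the same value in `Fin d`. -/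
def spider (d m n : ℕ) : Matrix (Fin m → Fin d) (Fin n → Fin d) ℂ :=
  fun j k => if ∃ c : Fin d, (∀ a, j a = c) ∧ (∀ b, k b = c) then 1 else 0

/-- Spider fusion: composing spiders along at least one wire yields a spider. -/
theorem spider_fusion (d m n k : ℕ) (hm : 1 ≤ m) (hn : 1 ≤ n) :
    spider d n m * spider d m k = spider d n k := by
  ext j l
  simp only [Matrix.mul_apply, spider]
  by_cases h : ∃ c : Fin d, (∀ a, j a = c) ∧ ∀ b, l b = c
  · obtain ⟨c, hj, hl⟩ := h
    rw [if_pos ⟨c, hj, hl⟩, Finset.sum_eq_single (fun _ => c)]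
    · rw [if_pos ⟨c, hj, fun _ => rfl⟩, if_pos ⟨c, fun _ => rfl, hl⟩, one_mul]
    · intro i _ hi
      rw [if_neg, zero_mul]
      rintro ⟨c', hj', hi'⟩
      obtain rfl : c = c' := (hj ⟨0, hn⟩).symm.trans (hj' ⟨0, hn⟩)
      exact hi (funext hi')
    · simp
  · rw [if_neg h]
    refine Finset.sum_eq_zero fun i _ => ?_
    rw [ite_zero_mul_ite_zero, if_neg]
    rintro ⟨⟨c, hj, hi⟩, c', hi', hl⟩
    obtain rfl : c = c' := (hi ⟨0, hm⟩).symm.trans (hi' ⟨0, hm⟩)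
    exact h ⟨c, hj, hl⟩
end

section
/- Explicit Naimark construction: let g : ι → Matrix (Fin d) (Fin d) ℂ be a finite family. Define V : Matrix (ι × Fin d) (Fin d) ℂ by V (i,k) l = g i k l, and P : ι → Matrix (ι × Fin d) (ι × Fin d) ℂ by P i ((j,k),(j',k')) = if j = i ∧ j' = i ∧ k = k' then 1 else 0. Then: (a) Vᴴ * V = ∑ i, (g i)ᴴ * (g i), so V is an isometry whenever ∑ i, (g i)ᴴ * (g i) = 1; (b) each P i is self-adjoint and idempotent, P i * P j = 0 for i ≠ j, and ∑ i, P i = 1; (c) Vᴴ * P i * V = (g i)ᴴ * (g i) for every i. -/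
open Matrix

/-- Explicit Naimark construction: stacking the Kraus operators `g i`
vertically gives a map `V` into the extended space `ℂ^ι ⊗ ℂ^d`, and the block
projections `P i` form a projective measurement whose compression by `V`
recovers the POVM elements `(g i)ᴴ * (g i)`. -/
theorem naimark_explicit_construction {ι : Type*} [Fintype ι] [DecidableEq ι]
    {d : ℕ}
    (g : ι → Matrix (Fin d) (Fin d) ℂ)
    (V : Matrix (ι × Fin d) (Fin d) ℂ)
    (hV : ∀ (i : ι) (k l : Fin d), V (i, k) l = g i k l)
    (P : ι → Matrix (ι × Fin d) (ι × Fin d) ℂ)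
    (hP : ∀ (i j j' : ι) (k k' : Fin d),
      P i (j, k) (j', k') = if j = i ∧ j' = i ∧ k = k' then 1 else 0) :
    (Vᴴ * V = ∑ i, (g i)ᴴ * (g i)) ∧
    (∀ i, (P i)ᴴ = P i) ∧
    (∀ i, P i * P i = P i) ∧
    (∀ i j, i ≠ j → P i * P j = 0) ∧
    (∑ i, P i = 1) ∧
    (∀ i, Vᴴ * P i * V = (g i)ᴴ * (g i)) := by
  have hdiag (i : ι) : P i = diagonal fun x => if x.1 = i then 1 else 0 := by
    ext ⟨j, k⟩ ⟨j', k'⟩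
    rw [hP, diagonal_apply]
    simp only [Prod.mk.injEq]
    grind
  refine ⟨?_, fun i => ?_, fun i => ?_, fun i j hij => ?_, ?_, fun i => ?_⟩
  · ext a b
    simp [mul_apply, Matrix.sum_apply, Fintype.sum_prod_type, hV]
  · rw [hdiag, diagonal_conjTranspose]
    congr 1
    ext x
    simp [apply_ite]
  · simp [hdiag]
  · rw [hdiag, hdiag, diagonal_mul_diagonal, ← diagonal_zero]
    congr 1
    ext x
    grind
  · ext x y
    by_cases hxy : x = y <;> simp [hdiag, Matrix.sum_apply, one_apply, hxy]
  · ext a b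
    rw [hdiag, Matrix.mul_assoc, mul_apply]
    simp [diagonal_mul, Fintype.sum_prod_type_right, hV, mul_apply (M := (g i)ᴴ)]
end
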